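/- For every integer n ≥ 4, every reset word of minimum length for the automaton 𝒟'_n ends with the letter a and sends every state to the state 2, i.e., δ(q,w) = 2 for all states q. -/

import Mathlib

/-- The two input letters of the automaton. -/
inductive Letter | a | b

/-- Transition function of the automaton `𝒟'ₙ` on states `{1, …, n}`:
`δ(i,a) = δ(i,b) = i+1` for `1 ≤ i ≤ n-2`, `δ(n-1,a) = 1`, `δ(n-1,b) = n`,
`δ(n,a) = 2`, `δ(n,b) = 1`. -/
def delta (n : ℕ) (q : ℕ) : Letter → ℕ
  | Letter.a => if q < n - 1 then q + 1 else if q = n - 1 then 1 else 2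
  | Letter.b => if q < n - 1 then q + 1 else if q = n - 1 then n else 1

/-- `w` is a reset word: it sends every state in `{1, …, n}` to one single state. -/
def IsReset (n : ℕ) (w : List Letter) : Prop :=
  ∃ p : ℕ, ∀ q ∈ Finset.Icc 1 n, w.foldl (delta n) q = p

theorem delta_mem_Icc {n q : ℕ} (hn : 4 ≤ n) (hq : q ∈ Finset.Icc 1 n) (l : Letter) :
    delta n q l ∈ Finset.Icc 1 n := by
  rw [Finset.mem_Icc] at *
  cases l <;> simp only [delta] <;> split_ifs <;> omega

theorem foldl_delta_mem_Icc {n : ℕ} (hn : 4 ≤ n) (w : List Letter) {q : ℕ}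
    (hq : q ∈ Finset.Icc 1 n) : w.foldl (delta n) q ∈ Finset.Icc 1 n := by
  induction w generalizing q with
  | nil => exact hq
  | cons l w ih => exact ih (delta_mem_Icc hn hq l)

/-- The letter `b` permutes the states cyclically. -/
theorem eq_of_delta_b_eq {n x p : ℕ} (hn : 4 ≤ n) (hx : x ∈ Finset.Icc 1 n)
    (h : delta n x Letter.b = p) : x = if p = 1 then n else p - 1 := by
  rw [Finset.mem_Icc] at hx
  simp only [delta] at h
  split_ifs at h ⊢ <;> omega

/-- The state `2` is the only one with more than one preimage under the letter `a`. -/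
theorem eq_of_delta_a_eq {n x p : ℕ} (hn : 4 ≤ n) (hx : x ∈ Finset.Icc 1 n) (hp : p ≠ 2)
    (h : delta n x Letter.a = p) : x = if p = 1 then n - 1 else p - 1 := by
  rw [Finset.mem_Icc] at hx
  simp only [delta] at h
  split_ifs at h ⊢ <;> omega

/-- Every reset word of minimum length for `𝒟'ₙ` ends with the letter `a` and sends
every state to the state `2`. -/
theorem dprime_min_reset_word (n : ℕ) (hn : 4 ≤ n)
    (w : List Letter) (hw : IsReset n w)
    (hmin : ∀ v : List Letter, IsReset n v → w.length ≤ v.length) :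
    (∃ w' : List Letter, w = w' ++ [Letter.a]) ∧
      ∀ q ∈ Finset.Icc 1 n, w.foldl (delta n) q = 2 := by
  obtain ⟨p, hp⟩ := hw
  rcases List.eq_nil_or_concat' w with rfl | ⟨v, l, rfl⟩
  · have h₁ := hp 1 (Finset.mem_Icc.2 (by omega))
    have h₂ := hp 2 (Finset.mem_Icc.2 (by omega))
    simp only [List.foldl_nil] at h₁ h₂
    omega
  have hv : ¬ IsReset n v := fun h => by
    have := hmin v h
    simp at this
  simp only [List.foldl_append, List.foldl_cons, List.foldl_nil] at hp ⊢
  cases l with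
  | b =>
    exact absurd ⟨_, fun q hq => eq_of_delta_b_eq hn (foldl_delta_mem_Icc hn v hq) (hp q hq)⟩ hv
  | a =>
    refine ⟨⟨v, rfl⟩, ?_⟩
    obtain rfl : p = 2 := by
      by_contra hp2
      exact hv ⟨_, fun q hq =>
        eq_of_delta_a_eq hn (foldl_delta_mem_Icc hn v hq) hp2 (hp q hq)⟩
    exact hp
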